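/- arXiv:2509.01779 — 2 statements merged into one kernel-verified Lean document; each statement's English description precedes it below -/
import Mathlib

section
/- Let L/K be a finite field extension. Every subalgebra of End_K(L) containing L (embedded via left multiplications) is of the form End_M(L) for a unique intermediate field M, namely M is the centralizer of the subalgebra in End_K(L) intersected with L; moreover the map M ↦ End_M(L) is an order-reversing bijection between intermediate fields of L/K and subalgebras of End_K(L) containing L. -/
/-- The subalgebra `End_M(L)` of `End_K(L)`, realized as the centralizer of the
multiplication operators by elements of the intermediate field `M`. -/
def endAlg (K L : Type*) [Field K] [Field L] [Algebra K L]
    (M : IntermediateField K L) : Subalgebra K (Module.End K L) :=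
  Subalgebra.centralizer K (Algebra.lmul K L '' (M : Set L))

theorem mem_endAlg_iff (K L : Type*) [Field K] [Field L] [Algebra K L]
    (M : IntermediateField K L) (f : Module.End K L) :
    f ∈ endAlg K L M ↔ ∀ x ∈ M, ∀ y, x * f y = f (x * y) := by
  unfold endAlg
  rw [Subalgebra.mem_centralizer_iff]
  constructor
  · intro h x hx y
    exact congrArg (fun g : Module.End K L => g y) (h _ ⟨x, hx, rfl⟩)
  · rintro h _ ⟨x, hx, rfl⟩
    exact LinearMap.ext fun y => h x hx y

theorem lmul_mem_centralizer_iff (K L : Type*) [Field K] [Field L] [Algebra K L]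
    (B : Subalgebra K (Module.End K L)) (x : L) :
    Algebra.lmul K L x ∈ Subalgebra.centralizer K (B : Set (Module.End K L)) ↔
      ∀ b ∈ B, ∀ y, b (x * y) = x * b y := by
  rw [Subalgebra.mem_centralizer_iff]
  constructor
  · intro h b hb y
    exact congrArg (fun g : Module.End K L => g y) (h b hb)
  · intro h b hb
    exact LinearMap.ext fun y => h b hb y

theorem mem_of_comm_endAlg (K L : Type*) [Field K] [Field L] [Algebra K L]
    (M : IntermediateField K L) (x : L)
    (h : ∀ b ∈ endAlg K L M, ∀ y, b (x * y) = x * b y) : x ∈ M := by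
  obtain ⟨p, hp⟩ := LinearMap.exists_leftInverse_of_injective (Algebra.linearMap M L)
    (LinearMap.ker_eq_bot.mpr (algebraMap M L).injective)
  have hp1 : p 1 = 1 := by
    have := congrArg (fun g => g 1) hp
    simpa using this
  let q : Module.End K L := ((Algebra.linearMap M L).comp p).restrictScalars K
  have hq : ∀ y, q y = (p y : L) := fun y => rfl
  have hqm : q ∈ endAlg K L M := by
    rw [mem_endAlg_iff]
    intro m hm y
    have := p.map_smul (⟨m, hm⟩ : M) y
    rw [hq, hq]
    have h2 := congrArg (fun z : M => (z : L)) this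
    exact h2.symm
  have := h q hqm 1
  rw [hq, hq, hp1] at this
  simp only [mul_one, OneMemClass.coe_one] at this
  rw [← this]
  exact (p x).2

theorem endAlg_injective (K L : Type*) [Field K] [Field L] [Algebra K L] :
    Function.Injective (endAlg K L) := by
  have key : ∀ M N : IntermediateField K L, endAlg K L M = endAlg K L N → M ≤ N := by
    intro M N h x hx
    apply mem_of_comm_endAlg
    intro b hb y
    rw [← h, mem_endAlg_iff] at hb
    exact (hb x hx y).symm
  intro M N h
  exact le_antisymm (key _ _ h) (key _ _ h.symm)

/-- The elements of `L` commuting with `B`. -/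
def centField (K L : Type*) [Field K] [Field L] [Algebra K L]
    (B : Subalgebra K (Module.End K L)) : IntermediateField K L :=
  Subalgebra.toIntermediateField
    ((Subalgebra.centralizer K (B : Set (Module.End K L))).comap (Algebra.lmul K L)) (by
      intro x hx
      rw [Subalgebra.mem_comap, lmul_mem_centralizer_iff] at hx ⊢
      intro b hb y
      by_cases h0 : x = 0
      · simp [h0]
      · have := hx b hb (x⁻¹ * y)
        rw [mul_inv_cancel_left₀ h0] at this
        rw [this, inv_mul_cancel_left₀ h0])

theorem mem_centField (K L : Type*) [Field K] [Field L] [Algebra K L]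
    (B : Subalgebra K (Module.End K L)) (x : L) :
    x ∈ centField K L B ↔
      Algebra.lmul K L x ∈ Subalgebra.centralizer K (B : Set (Module.End K L)) := Iff.rfl

theorem endAlg_centField (K L : Type*) [Field K] [Field L] [Algebra K L]
    [FiniteDimensional K L] (B : Subalgebra K (Module.End K L))
    (hB : (Algebra.lmul K L).range ≤ B) : endAlg K L (centField K L B) = B := by
  have hmul : ∀ x : L, Algebra.lmul K L x ∈ B := fun x => hB ⟨x, rfl⟩
  apply le_antisymm
  · intro f hf
    rw [mem_endAlg_iff] at hf
    have hsimple : IsSimpleModule B L := by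
      rw [isSimpleModule_iff_toSpanSingleton_surjective]
      refine ⟨inferInstance, fun v hv w => ⟨⟨_, hmul (w * v⁻¹)⟩, ?_⟩⟩
      change w * v⁻¹ * v = w
      exact inv_mul_cancel_right₀ hv w
    have hg : ∀ (g : Module.End B L) (y : L), g y = g 1 * y := by
      intro g y
      have : g (y * 1) = y * g 1 := g.map_smul (⟨_, hmul y⟩ : B) 1
      rw [mul_one] at this
      rw [this, mul_comm]
    have hgm : ∀ g : Module.End B L, g 1 ∈ centField K L B := by
      intro g
      rw [mem_centField, lmul_mem_centralizer_iff]
      intro b hb y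
      have : g (b y) = b (g y) := g.map_smul (⟨b, hb⟩ : B) y
      rw [← hg, ← hg, this]
    let F : Module.End (Module.End B L) L :=
      { toFun := f
        map_add' := f.map_add
        map_smul' := by
          intro g y
          change f (g y) = g (f y)
          rw [hg g y, hg g (f y), hf _ (hgm g)] }
    let bs := Module.finBasis K L
    classical
    obtain ⟨r, hr⟩ := jacobson_density (R := B) F (Finset.univ.image bs)
    have : f = (r : Module.End K L) := bs.ext fun i => hr (bs i) (by simp)
    rw [this]
    exact r.2
  · intro b hb
    rw [mem_endAlg_iff]
    intro x hx y
    rw [mem_centField, lmul_mem_centralizer_iff] at hx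
    exact (hx b hb y).symm

/-- For a finite extension `L/K`, the map `M ↦ End_M(L)` is an order-reversing
bijection from intermediate fields of `L/K` to subalgebras of `End_K(L)` containing
`L`; the inverse sends a subalgebra `B` to (the elements of `L` lying in) the
centralizer of `B`. -/
theorem stmt6 (K L : Type*) [Field K] [Field L] [Algebra K L] [FiniteDimensional K L] :
    (∀ M : IntermediateField K L, (Algebra.lmul K L).range ≤ endAlg K L M) ∧
    (∀ M N : IntermediateField K L, M ≤ N → endAlg K L N ≤ endAlg K L M) ∧
    Function.Injective (endAlg K L) ∧
    (∀ B : Subalgebra K (Module.End K L), (Algebra.lmul K L).range ≤ B →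
      ∃! M : IntermediateField K L, endAlg K L M = B ∧
        ∀ x : L, x ∈ M ↔
          Algebra.lmul K L x ∈ Subalgebra.centralizer K (B : Set (Module.End K L))) := by
  refine ⟨?_, ?_, endAlg_injective K L, ?_⟩
  · rintro M _ ⟨x, rfl⟩
    refine (mem_endAlg_iff K L M _).mpr fun m _ y => ?_
    exact mul_left_comm m x y
  · intro M N h f hf
    rw [mem_endAlg_iff] at hf ⊢
    exact fun x hx => hf x (h hx)
  · intro B hB
    refine ⟨centField K L B, ⟨endAlg_centField K L B hB, mem_centField K L B⟩, ?_⟩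
    rintro M ⟨hM, _⟩
    exact endAlg_injective K L (hM.trans (endAlg_centField K L B hB).symm)
end

section
/- Let L/K be a finite field extension with char K = p > 0. Then D(L/K) equals the subalgebra of End_K(L) generated by L and Der_K(L) if and only if l^p ∈ L^{sep} for all l ∈ L, i.e. iff the extension L/L^{sep} is purely inseparable of exponent ≤ 1. -/
/-- The filtration of Grothendieck differential operators on the `K`-algebra `L`:
`D_0` is the set of multiplication operators and
`D_{i+1} = {δ : [δ, l·] ∈ D_i for all l ∈ L}`. -/
def diffOpFil (K L : Type*) [Field K] [Field L] [Algebra K L] :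
    ℕ → Set (Module.End K L)
  | 0 => Set.range ⇑(Algebra.lmul K L)
  | n + 1 =>
      {δ | ∀ l : L, δ * Algebra.lmul K L l - Algebra.lmul K L l * δ ∈ diffOpFil K L n}

/-- The algebra `D(L/K)` of Grothendieck differential operators on `L` over `K`,
as a subset of `End_K(L)`: the union of the filtration `diffOpFil`. -/
def diffOps (K L : Type*) [Field K] [Field L] [Algebra K L] : Set (Module.End K L) :=
  ⋃ n, diffOpFil K L n

/-- The set of `K`-linear derivations of `L`, inside `End_K(L)`. -/
def derSet (K L : Type*) [Field K] [Field L] [Algebra K L] : Set (Module.End K L) :=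
  {δ | ∀ x y : L, δ (x * y) = x * δ y + δ x * y}

section Aux

open Polynomial TensorProduct

variable {K L : Type*} [Field K] [Field L] [Algebra K L]

lemma aux_aeval (δ : Module.End K L) (s : L)
    (h : ∀ x, δ (s * (s * x)) - s * δ (s * x) = s * (δ (s * x) - s * δ x)) (f : K[X]) (x : L) :
    δ (aeval s f * x) - aeval s f * δ x = aeval s (derivative f) * (δ (s * x) - s * δ x) := by
  have hpow : ∀ n : ℕ, ∀ x, δ (s ^ (n + 1) * x) - s ^ (n + 1) * δ x
      = (n + 1) * s ^ n * (δ (s * x) - s * δ x) := by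
    intro n
    induction n with
    | zero => intro x; simp
    | succ n ih =>
      intro x
      have e1 := ih (s * x)
      have e2 := h x
      have e3 : s ^ (n + 1 + 1) * x = s ^ (n + 1) * (s * x) := by ring
      rw [e3]
      push_cast
      rw [e2] at e1
      linear_combination e1
  induction f using Polynomial.induction_on' with
  | add f g hf hg =>
    simp only [map_add, add_mul]
    linear_combination hf + hg
  | monomial n a =>
    cases n with
    | zero =>
      simp [← Algebra.smul_def]
    | succ n =>
      have := hpow n x
      simp only [aeval_monomial, derivative_monomial, map_mul, map_natCast, Nat.add_sub_cancel]
      rw [mul_assoc, ← Algebra.smul_def, map_smul, Algebra.smul_def]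
      push_cast
      linear_combination (algebraMap K L a) * this

/-- Differential operators are linear over the separable closure. -/
lemma aux_commute (n : ℕ) : ∀ δ ∈ diffOpFil K L n, ∀ s ∈ separableClosure K L, ∀ x : L,
    δ (s * x) = s * δ x := by
  induction n with
  | zero =>
    rintro _ ⟨l, rfl⟩ s hs x
    simp [mul_left_comm]
  | succ n ih =>
    intro δ hδ s hs x
    have h1 := fun x => ih _ (hδ s) s hs x
    simp only [LinearMap.sub_apply, Module.End.mul_apply, Algebra.coe_lmul_eq_mul,
      LinearMap.mul_apply'] at h1
    have h2 := aux_aeval δ s h1 (minpoly K s) x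
    rw [minpoly.aeval] at h2
    have hsep : IsSeparable K s := mem_separableClosure_iff.1 hs
    have h3 : aeval s (derivative (minpoly K s)) ≠ 0 :=
      Polynomial.Separable.aeval_derivative_ne_zero hsep (minpoly.aeval K s)
    simp only [zero_mul, map_zero, sub_self] at h2
    rcases mul_eq_zero.1 h2.symm with h | h
    · exact absurd h h3
    · exact sub_eq_zero.1 h

lemma derSet_one {δ : Module.End K L} (h : δ ∈ derSet K L) : δ 1 = 0 := by
  have := h 1 1
  simpa using this

lemma derSet_fil {δ : Module.End K L} (h : δ ∈ derSet K L) : δ ∈ diffOpFil K L 1 := by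
  intro l
  refine ⟨δ l, ?_⟩
  ext x
  have := h l x
  simp [this]

lemma derSet_pow {δ : Module.End K L} (h : δ ∈ derSet K L) (l : L) (n : ℕ) :
    δ (l ^ (n + 1)) = (n + 1) * l ^ n * δ l := by
  induction n with
  | zero => simp
  | succ n ih =>
    rw [pow_succ, h, ih]
    push_cast
    ring

/-- Linear endomorphisms over the separable closure are differential operators. -/
lemma aux_nilp [FiniteDimensional K L] (p : ℕ) (hp : p.Prime) [CharP K p] :
    ∃ N, (KaehlerDifferential.ideal (separableClosure K L) L) ^ N = ⊥ := by
  have : Fact p.Prime := ⟨hp⟩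
  have : CharP (separableClosure K L) p := charP_of_injective_algebraMap (algebraMap K _).injective p
  have : CharP L p := charP_of_injective_algebraMap (algebraMap K _).injective p
  have : ExpChar (separableClosure K L) p := .prime hp
  set S := separableClosure K L
  have hT : CharP (L ⊗[S] L) p :=
    charP_of_injective_algebraMap (algebraMap L (L ⊗[S] L)).injective p
  have : ExpChar (L ⊗[S] L) p := .prime hp
  have hfg := KaehlerDifferential.ideal_fg S L
  have := (Ideal.FG.isNilpotent_iff_le_nilradical hfg).2 ?_
  · exact this
  · rw [← KaehlerDifferential.span_range_eq_ideal, Ideal.span_le]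
    rintro _ ⟨l, rfl⟩
    obtain ⟨s, hs⟩ := IsPurelyInseparable.exponent_def' S p l
    refine ⟨p ^ IsPurelyInseparable.exponent S L, ?_⟩
    simp only
    rw [sub_pow_expChar_pow, Algebra.TensorProduct.tmul_pow, Algebra.TensorProduct.tmul_pow, ← hs,
      one_pow, Algebra.algebraMap_eq_smul_one, TensorProduct.tmul_smul, TensorProduct.smul_tmul',
      sub_self]
    exact Ideal.zero_mem _

lemma aux_fil (S : Type*) [Field S] [Algebra S L] (φ : (L ⊗[S] L) →ₐ[S] Module.End S (Module.End S L))
    (hφ : ∀ l δ, φ ((1 : L) ⊗ₜ[S] l - l ⊗ₜ[S] (1 : L)) δ =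
      δ * Algebra.lmul S L l - Algebra.lmul S L l * δ) (n : ℕ) : ∀ δ : Module.End S L,
    (∀ x ∈ KaehlerDifferential.ideal S L ^ n, φ x δ ∈ diffOpFil S L 0) →
      δ ∈ diffOpFil S L n := by
  induction n with
  | zero =>
    intro δ h
    simpa using h 1 (by simp)
  | succ n ih =>
    intro δ h l
    apply ih
    intro x hx
    rw [← hφ, ← Module.End.mul_apply, ← map_mul]
    apply h
    rw [pow_succ]
    exact Ideal.mul_mem_mul hx (KaehlerDifferential.one_smul_sub_smul_one_mem_ideal _ _)

lemma aux_phi (S : Type*) [Field S] [Algebra S L] :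
    ∃ φ : (L ⊗[S] L) →ₐ[S] Module.End S (Module.End S L),
    (∀ l δ, φ ((1 : L) ⊗ₜ[S] l - l ⊗ₜ[S] (1 : L)) δ =
      δ * Algebra.lmul S L l - Algebra.lmul S L l * δ) := by
  obtain ⟨g, hg⟩ : ∃ g : L →ₐ[S] Module.End S (Module.End S L),
      ∀ l δ, g l δ = δ * Algebra.lmul S L l :=
    ⟨AlgHom.ofLinearMap
      ((LinearMap.mul S (Module.End S L)).flip.comp (Algebra.lmul S L).toLinearMap)
      (by ext; simp) (by
        intro x y
        ext δ z
        simp [mul_left_comm, mul_assoc]), fun l δ => rfl⟩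
  obtain ⟨f, hf⟩ : ∃ f : L →ₐ[S] Module.End S (Module.End S L),
      ∀ l δ, f l δ = Algebra.lmul S L l * δ :=
    ⟨(Algebra.lmul S (Module.End S L)).comp (Algebra.lmul S L), fun l δ => rfl⟩
  have hc : ∀ x y, Commute (f x) (g y) := by
    intro x y
    rw [commute_iff_eq]
    apply LinearMap.ext
    intro δ
    simp only [Module.End.mul_apply, hf, hg, mul_assoc]
  have key : ∀ x y δ, Algebra.TensorProduct.lift f g hc (x ⊗ₜ[S] y) δ = f x (g y δ) := by
    intro x y δ
    have := Algebra.TensorProduct.lift_tmul f g hc x y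
    exact congrArg (fun h : Module.End S (Module.End S L) => h δ) this
  refine ⟨Algebra.TensorProduct.lift f g hc, ?_⟩
  intro l δ
  rw [map_sub, LinearMap.sub_apply, key, key]
  simp only [hf, hg, map_one, Module.End.one_apply]

lemma aux_restrict (S : IntermediateField K L) (n : ℕ) : ∀ δ ∈ diffOpFil S L n,
    LinearMap.restrictScalars K δ ∈ diffOpFil K L n := by
  induction n with
  | zero =>
    rintro _ ⟨l, rfl⟩
    exact ⟨l, rfl⟩
  | succ n ih =>
    intro δ h l
    exact ih _ (h l)

lemma aux_mem [FiniteDimensional K L] (p : ℕ) (hp : p.Prime) [CharP K p] (δ : Module.End K L)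
    (h : ∀ s ∈ separableClosure K L, ∀ x : L, δ (s * x) = s * δ x) : δ ∈ diffOps K L := by
  obtain ⟨N, hN⟩ := aux_nilp (K := K) (L := L) p hp
  obtain ⟨φ, hφ⟩ := aux_phi (L := L) (separableClosure K L)
  let δ' : Module.End (separableClosure K L) L :=
    { toFun := δ
      map_add' := map_add δ
      map_smul' := fun s x => h s s.2 x }
  have : δ' ∈ diffOpFil (separableClosure K L) L N := by
    apply aux_fil _ φ hφ
    intro x hx
    rw [hN] at hx
    have hx0 : x = 0 := hx
    subst hx0
    exact ⟨0, by simp⟩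
  exact Set.mem_iUnion.2 ⟨N, aux_restrict _ N _ this⟩

lemma aux_finrank (M : IntermediateField K L) (p : ℕ) (hp : p.Prime) [CharP K p] (b : L)
    (hb : b ∉ M) (hbp : b ^ p ∈ M) :
    Module.finrank M (IntermediateField.adjoin M {b}) = p := by
  have : Fact p.Prime := ⟨hp⟩
  have : CharP L p := charP_of_injective_algebraMap (algebraMap K _).injective p
  have hirr : Irreducible (X ^ p - C (⟨b ^ p, hbp⟩ : M)) := by
    apply X_pow_sub_C_irreducible_of_prime hp
    intro c hc
    have : (c : L) ^ p = b ^ p := congrArg Subtype.val hc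
    have := frobenius_inj L p this
    exact hb (this ▸ c.2)
  have hmonic : (X ^ p - C (⟨b ^ p, hbp⟩ : M)).Monic := monic_X_pow_sub_C _ hp.ne_zero
  have hroot : aeval b (X ^ p - C (⟨b ^ p, hbp⟩ : M)) = 0 := by
    simp [IntermediateField.algebraMap_apply]
  have hmin := minpoly.eq_of_irreducible_of_monic hirr hroot hmonic
  rw [IntermediateField.adjoin.finrank ⟨_, hmonic, hroot⟩, ← hmin, natDegree_X_pow_sub_C]

lemma aux_der [FiniteDimensional K L] (p : ℕ) (hp : p.Prime) [CharP K p]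
    (h : ∀ l : L, l ^ p ∈ separableClosure K L) (a : L) (ha : a ∉ separableClosure K L) :
    ∃ δ ∈ derSet K L, δ a ≠ 0 := by
  have hmono : StrictMono (fun M : IntermediateField K L =>
      Subalgebra.toSubmodule M.toSubalgebra) := by
    intro M N hMN
    exact hMN
  have : WellFoundedGT (IntermediateField K L) := hmono.wellFoundedGT
  obtain ⟨M, ⟨hSM, haM⟩, hmax⟩ := (wellFounded_gt (α := IntermediateField K L)).has_min
    {M | separableClosure K L ≤ M ∧ a ∉ M} ⟨_, le_rfl, ha⟩
  have htop : IntermediateField.adjoin M {a} = ⊤ := by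
    rw [eq_top_iff]
    intro b _
    by_cases hb : b ∈ M
    · exact (IntermediateField.adjoin M {a}).algebraMap_mem ⟨b, hb⟩
    · have hlt : M < (IntermediateField.adjoin M {b}).restrictScalars K := by
        refine lt_of_le_of_ne ?_ ?_
        · intro x hx
          exact (IntermediateField.adjoin M {b}).algebraMap_mem ⟨x, hx⟩
        · intro e
          apply hb
          rw [e]
          exact IntermediateField.mem_adjoin_simple_self M b
      have hab : a ∈ IntermediateField.adjoin M {b} := by
        by_contra hc
        exact hmax _ ⟨hSM.trans hlt.le, hc⟩ hlt
      have hle : IntermediateField.adjoin M {a} ≤ IntermediateField.adjoin M {b} := by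
        rw [IntermediateField.adjoin_simple_le_iff]
        exact hab
      have := IntermediateField.eq_of_le_of_finrank_eq hle (by
        rw [aux_finrank M p hp a haM (hSM (h a)), aux_finrank M p hp b hb (hSM (h b))])
      rw [this]
      exact IntermediateField.mem_adjoin_simple_self M b
  have hns : ¬ Subsingleton (Ω[L⁄M]) := by
    intro hs
    have hu : Algebra.FormallyUnramified M L := ⟨hs⟩
    have hsep := (Algebra.FormallyUnramified.iff_isSeparable M L).1 hu
    have hsa := hsep.isSeparable' a
    have hKM : a ∈ separableClosure M L := mem_separableClosure_iff.2 hsa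
    have : Fact p.Prime := ⟨hp⟩
    have : CharP M p := charP_of_injective_algebraMap (algebraMap K _).injective p
    have : ExpChar M p := .prime hp
    have hpi : IsPurelyInseparable M L := by
      rw [isPurelyInseparable_iff_pow_mem M p]
      intro x
      exact ⟨1, ⟨x ^ p, hSM (h x)⟩, by simp [IntermediateField.algebraMap_apply]⟩
    obtain ⟨y, hy⟩ := IsPurelyInseparable.inseparable M a hsa
    exact haM (hy ▸ y.2)
  have hnt : Nontrivial (Ω[L⁄M]) := not_subsingleton_iff_nontrivial.1 hns
  obtain ⟨w, hw⟩ := exists_ne (0 : Ω[L⁄M])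
  obtain ⟨f, hf⟩ : ∃ f : Module.Dual L (Ω[L⁄M]), f w ≠ 0 := by
    by_contra! hc
    exact hw ((Module.forall_dual_apply_eq_zero_iff L w).1 hc)
  let D : Derivation M L L := f.compDer (KaehlerDifferential.D M L)
  refine ⟨LinearMap.restrictScalars K (D : L →ₗ[M] L), ?_, ?_⟩
  · intro x y
    change D (x * y) = x * D y + D x * y
    rw [D.leibniz, smul_eq_mul, smul_eq_mul, mul_comm y]
  · intro hDa
    change D a = 0 at hDa
    have hD : D = 0 := by
      have htop' : Algebra.adjoin M {a} = ⊤ := by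
        rw [← IntermediateField.adjoin_simple_toSubalgebra_of_isAlgebraic
          (Algebra.IsAlgebraic.isAlgebraic a), htop]
        rfl
      refine Derivation.ext_of_adjoin_eq_top {a} htop' ?_
      intro x hx
      rw [Set.mem_singleton_iff.1 hx, hDa]
      rfl
    have hf0 : f = 0 := by
      apply Derivation.liftKaehlerDifferential_unique
      change D = _
      rw [hD]
      ext x
      simp
    exact hf (by rw [hf0]; rfl)

lemma aux_dense [FiniteDimensional K L] (p : ℕ) (hp : p.Prime) [CharP K p]
    (h : ∀ l : L, l ^ p ∈ separableClosure K L) (δ : Module.End K L)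
    (hδ : ∀ s ∈ separableClosure K L, ∀ x : L, δ (s * x) = s * δ x) :
    δ ∈ Algebra.adjoin K (Set.range ⇑(Algebra.lmul K L) ∪ derSet K L) := by
  set R := Algebra.adjoin K (Set.range ⇑(Algebra.lmul K L) ∪ derSet K L) with hR
  have hmul : ∀ l : L, Algebra.lmul K L l ∈ R := fun l =>
    Algebra.subset_adjoin (Or.inl ⟨l, rfl⟩)
  have hder : ∀ d ∈ derSet K L, d ∈ R := fun d hd => Algebra.subset_adjoin (Or.inr hd)
  have : IsSimpleModule R L := by
    rw [isSimpleModule_iff_toSpanSingleton_surjective]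
    refine ⟨inferInstance, fun m hm y => ⟨⟨_, hmul (y * m⁻¹)⟩, ?_⟩⟩
    change y * m⁻¹ * m = y
    field_simp
  have hend : ∀ g : Module.End R L, g 1 ∈ separableClosure K L ∧ ∀ x, g x = g 1 * x := by
    intro g
    constructor
    · by_contra hc
      obtain ⟨d, hd, hne⟩ := aux_der p hp h _ hc
      have := g.map_smul (⟨d, hder d hd⟩ : R) 1
      change g (d 1) = d (g 1) at this
      rw [derSet_one hd, map_zero] at this
      exact hne this.symm
    · intro x
      have := g.map_smul (⟨_, hmul x⟩ : R) 1
      change g (x * 1) = x * g 1 at this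
      rw [mul_one] at this
      rw [this, mul_comm]
  let b := Module.finBasis K L
  classical
  obtain ⟨r, hr⟩ := jacobson_density (R := R) (M := L)
    { toFun := δ
      map_add' := map_add δ
      map_smul' := fun g x => by
        change δ (g x) = g (δ x)
        rw [(hend g).2, (hend g).2 (δ x), hδ _ (hend g).1] } (Finset.univ.image b)
  have : δ = r := by
    apply b.ext
    intro i
    exact hr (b i) (by simp)
  rw [this]
  exact r.2

/-- Elements of the derivation algebra commute with elements killed by derivations. -/
lemma aux_adjoin (s : L) (hs : ∀ d ∈ derSet K L, ∀ x, d (s * x) = s * d x) (δ : Module.End K L)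
    (hδ : δ ∈ Algebra.adjoin K (Set.range ⇑(Algebra.lmul K L) ∪ derSet K L)) (x : L) :
    δ (s * x) = s * δ x := by
  induction hδ using Algebra.adjoin_induction generalizing x with
  | mem y hy =>
    rcases hy with ⟨l, rfl⟩ | hy
    · simp [mul_left_comm]
    · exact hs y hy x
  | algebraMap r => simp
  | add a b _ _ ha hb => simp [ha, hb, mul_add]
  | mul a b _ _ ha hb => simp [ha, hb]

end Aux

/-- For a finite extension `L/K` with `char K = p > 0`, `D(L/K)` equals the subalgebra
of `End_K(L)` generated by `L` and `Der_K(L)` if and only if `l^p ∈ L^{sep}` for all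
`l ∈ L`, i.e. iff `L/L^{sep}` is purely inseparable of exponent at most one. -/
theorem stmt16 (K L : Type*) [Field K] [Field L] [Algebra K L] [FiniteDimensional K L]
    (p : ℕ) (hp : p.Prime) [CharP K p] :
    diffOps K L =
        (Algebra.adjoin K (Set.range ⇑(Algebra.lmul K L) ∪ derSet K L) :
          Set (Module.End K L)) ↔
      ∀ l : L, l ^ p ∈ separableClosure K L := by
  constructor
  · intro h l
    by_contra hl
    have hLp : CharP L p := charP_of_injective_algebraMap (algebraMap K _).injective p
    -- a linear functional over the separable closure
    have hmk : (Submodule.span (separableClosure K L) {(1 : L)}).mkQ (l ^ p) ≠ 0 := by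
      rw [Submodule.mkQ_apply, Ne, Submodule.Quotient.mk_eq_zero, Submodule.mem_span_singleton]
      rintro ⟨s, hs⟩
      apply hl
      rw [← hs, Algebra.smul_def, mul_one]
      exact s.2
    obtain ⟨f, hf⟩ : ∃ f : Module.Dual (separableClosure K L) (L ⧸ Submodule.span (separableClosure K L) {(1 : L)}),
        f ((Submodule.span (separableClosure K L) {(1 : L)}).mkQ (l ^ p)) ≠ 0 := by
      by_contra! hc
      exact hmk ((Module.forall_dual_apply_eq_zero_iff _ _).1 hc)
    let δ : Module.End K L := LinearMap.restrictScalars K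
      ((Algebra.linearMap (separableClosure K L) L).comp
        (f.comp (Submodule.span (separableClosure K L) {(1 : L)}).mkQ))
    have h1 : δ ∈ diffOps K L := by
      apply aux_mem p hp
      intro s hs x
      exact LinearMap.map_smul ((Algebra.linearMap (separableClosure K L) L).comp
        (f.comp (Submodule.span (separableClosure K L) {(1 : L)}).mkQ)) (⟨s, hs⟩ : separableClosure K L) x
    rw [h] at h1
    have h2 := aux_adjoin (l ^ p) (fun d hd x => by
      obtain ⟨n, rfl⟩ := Nat.exists_eq_succ_of_ne_zero hp.ne_zero
      have hz : ((n : L) + 1) = 0 := by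
        have := CharP.cast_eq_zero L (n + 1)
        push_cast at this
        exact this
      rw [hd, Nat.succ_eq_add_one, derSet_pow hd, hz]
      ring) δ h1 1
    have h3 : δ 1 = 0 := by
      have : (Submodule.span (separableClosure K L) {(1 : L)}).mkQ 1 = 0 := by
        rw [Submodule.mkQ_apply, Submodule.Quotient.mk_eq_zero]
        exact Submodule.mem_span_singleton_self 1
      simp [δ, -Submodule.mkQ_apply, this]
    rw [h3, mul_one, mul_zero] at h2
    apply hf
    apply (algebraMap (separableClosure K L) L).injective
    rw [map_zero]
    exact h2
  · intro h
    apply Set.Subset.antisymm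
    · intro δ hδ
      obtain ⟨n, hn⟩ := Set.mem_iUnion.1 hδ
      exact aux_dense p hp h δ (aux_commute n δ hn)
    · intro δ hδ
      apply aux_mem p hp
      intro s hs x
      exact aux_adjoin s (fun d hd => aux_commute 1 d (derSet_fil hd) s hs) δ hδ x
end
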